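/- (Main theorem) Let β ≥ 1 and c ∈ (0,1). There exists α = α(β,c) > 0 such that any ⟦n,k,d⟧ stabilizer code whose connectivity graph G satisfies s_G(r) ≤ β·r^c for all r obeys k·d^{(1−c²)/c} ≤ α·n. -/

import Mathlib

open scoped Classical ComplexOrder
open Finset

/-- Outer boundary: vertices outside `U` adjacent to some vertex of `U`. -/
noncomputable def outerBoundary {V : Type*} [Fintype V] (G : SimpleGraph V) (U : Finset V) :
    Finset V :=
  Finset.univ.filter fun v => v ∉ U ∧ ∃ u ∈ U, G.Adj u v

/-- Inner boundary: vertices of `U` adjacent to some vertex outside `U`. -/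
noncomputable def innerBoundary {V : Type*} [Fintype V] (G : SimpleGraph V) (U : Finset V) :
    Finset V :=
  Finset.univ.filter fun u => u ∈ U ∧ ∃ v, v ∉ U ∧ G.Adj u v

/-- Two vertex sets are disconnected: no edge of `G` joins them. -/
def Disconn {V : Type*} (G : SimpleGraph V) (A B : Finset V) : Prop :=
  ∀ a ∈ A, ∀ b ∈ B, ¬ G.Adj a b

/-- A `d`-correctable family of a graph `G`: closed under subsets (Trivial), contains all
sets of size `< d` (Distance), closed under unions of pairwise disjoint pairwise
disconnected members (Union), and closed under expansion (Expansion). -/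
def IsCorrectableFamily {V : Type*} [Fintype V] [DecidableEq V] (G : SimpleGraph V) (d : ℕ)
    (F : Set (Finset V)) : Prop :=
  (∀ U ∈ F, ∀ W ⊆ U, W ∈ F) ∧
  (∀ U : Finset V, U.card < d → U ∈ F) ∧
  (∀ (ℓ : ℕ) (U : Fin ℓ → Finset V), (∀ i, U i ∈ F) →
    (∀ i j, i ≠ j → Disjoint (U i) (U j) ∧ Disconn G (U i) (U j)) →
    Finset.univ.biUnion U ∈ F) ∧
  (∀ U ∈ F, ∀ T ∈ F, outerBoundary G U ⊆ T → U ∪ T ∈ F)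

/-- A set is `d`-correctable with respect to `G` if it belongs to every
`d`-correctable family of `G`. -/
def IsCorrectableSet {V : Type*} [Fintype V] [DecidableEq V] (G : SimpleGraph V) (d : ℕ)
    (U : Finset V) : Prop :=
  ∀ F : Set (Finset V), IsCorrectableFamily G d F → U ∈ F

/-- The (induced subgraph on) `H` admits a 2/3-balanced separator of size at most `t`. -/
def SepUpTo {V : Type*} [DecidableEq V] (G : SimpleGraph V) (H : Finset V) (t : ℝ) : Prop :=
  ∃ T U₁ U₂ : Finset V, T ∪ U₁ ∪ U₂ = H ∧
    Disjoint T U₁ ∧ Disjoint T U₂ ∧ Disjoint U₁ U₂ ∧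
    Disconn G U₁ U₂ ∧
    3 * U₁.card ≤ 2 * H.card ∧ 3 * U₂.card ≤ 2 * H.card ∧
    (T.card : ℝ) ≤ t

/-- `G` has separation profile `s_G(r) ≤ β · r^c` for all `r`: every vertex subset `H`
admits a 2/3-balanced separator of size at most `β · |H|^c`. -/
def HasSepProfile {V : Type*} [DecidableEq V] (G : SimpleGraph V) (β c : ℝ) : Prop :=
  ∀ H : Finset V, SepUpTo G H (β * (H.card : ℝ) ^ c)

/-- `A` is a union of pairwise disjoint, pairwise disconnected components,
each of size at most `d - 1`. -/
def SmallComponents {V : Type*} [DecidableEq V] (G : SimpleGraph V) (d : ℕ)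
    (A : Finset V) : Prop :=
  ∃ (ℓ : ℕ) (U : Fin ℓ → Finset V), A = Finset.univ.biUnion U ∧
    (∀ i, (U i).card < d) ∧
    ∀ i j, i ≠ j → Disjoint (U i) (U j) ∧ Disconn G (U i) (U j)

/-- Computational-basis index set for `n` qubits. -/
abbrev QIdx (n : ℕ) := Fin n → ZMod 2

/-- The `n`-qubit Pauli operator `X^a Z^b` (as a matrix in the computational basis). -/
noncomputable def pauliXZ {n : ℕ} (a b : QIdx n) : Matrix (QIdx n) (QIdx n) ℂ :=
  fun f g => if f = g + a then (-1 : ℂ) ^ (∑ i, (b i * g i).val) else 0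

/-- Support of the Pauli operator `X^a Z^b`: qubits on which it acts nontrivially. -/
def pauliSupp {n : ℕ} (a b : QIdx n) : Finset (Fin n) :=
  Finset.univ.filter fun i => a i ≠ 0 ∨ b i ≠ 0

/-- A stabilizer code on `n` qubits given by `m` (signed, pairwise commuting) Pauli
generators, the `i`-th generator being `(sign i) · X^{(gen i).1} Z^{(gen i).2}`. -/
structure StabCode (n m : ℕ) where
  gen : Fin m → QIdx n × QIdx n
  sign : Fin m → ℂ
  sign_pm : ∀ i, sign i = 1 ∨ sign i = -1
  commute : ∀ i j,
    (∑ k, ((gen i).1 k * (gen j).2 k + (gen j).1 k * (gen i).2 k)) = (0 : ZMod 2)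

/-- The orthogonal projector onto the code space: `∏ i (I + S_i)/2`. -/
noncomputable def StabCode.proj {n m : ℕ} (S : StabCode n m) :
    Matrix (QIdx n) (QIdx n) ℂ :=
  ((2 : ℂ) ^ m)⁻¹ •
    (List.ofFn fun i : Fin m =>
      (1 : Matrix (QIdx n) (QIdx n) ℂ) + S.sign i • pauliXZ (S.gen i).1 (S.gen i).2).prod

/-- A code state: a density operator supported on the code space. -/
def IsCodeState {n m : ℕ} (S : StabCode n m) (ρ : Matrix (QIdx n) (QIdx n) ℂ) : Prop :=
  ρ.PosSemidef ∧ ρ.trace = 1 ∧ S.proj * ρ * S.proj = ρ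

/-- The code encodes `k` logical qubits: the code space has dimension `2^k`. -/
def HasDim {n m : ℕ} (S : StabCode n m) (k : ℕ) : Prop :=
  S.proj.trace = (2 : ℂ) ^ k

/-- The code has distance at least `d` (Knill–Laflamme conditions for all Pauli
errors of weight `< d`). -/
def HasDistanceGe {n m : ℕ} (S : StabCode n m) (d : ℕ) : Prop :=
  ∀ a b : QIdx n, (pauliSupp a b).card < d →
    ∃ z : ℂ, S.proj * pauliXZ a b * S.proj = z • S.proj

/-- Merge an assignment on the qubits outside `U` with one on `U`. -/
noncomputable def mergeIdx {n : ℕ} (U : Finset (Fin n)) (f : {i // i ∉ U} → ZMod 2)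
    (h : {i // i ∈ U} → ZMod 2) : QIdx n :=
  fun i => if hi : i ∈ U then h ⟨i, hi⟩ else f ⟨i, hi⟩

/-- Partial trace over the qubits in `U`. -/
noncomputable def ptrace {n : ℕ} (U : Finset (Fin n))
    (ρ : Matrix (QIdx n) (QIdx n) ℂ) :
    Matrix ({i // i ∉ U} → ZMod 2) ({i // i ∉ U} → ZMod 2) ℂ :=
  fun f g => ∑ h : ({i // i ∈ U} → ZMod 2), ρ (mergeIdx U f h) (mergeIdx U g h)

/-- A map on matrices is a quantum channel (CPTP) iff it admits a Kraus representation. -/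
def IsCPTP {A B : Type*} [Fintype A] [Fintype B] [DecidableEq A] [DecidableEq B]
    (Φ : Matrix A A ℂ → Matrix B B ℂ) : Prop :=
  ∃ (N : ℕ) (K : Fin N → Matrix B A ℂ),
    (∑ i, (K i).conjTranspose * K i = (1 : Matrix A A ℂ)) ∧
    ∀ ρ, Φ ρ = ∑ i, K i * ρ * (K i).conjTranspose

/-- A set `U` of qubits is correctable: some quantum channel recovers every code state
from its reduced state on the complement of `U`. -/
noncomputable def QCorrectable {n m : ℕ} (S : StabCode n m) (U : Finset (Fin n)) : Prop :=
  ∃ R : Matrix ({i // i ∉ U} → ZMod 2) ({i // i ∉ U} → ZMod 2) ℂ →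
        Matrix (QIdx n) (QIdx n) ℂ,
    IsCPTP R ∧ ∀ ρ, IsCodeState S ρ → R (ptrace U ρ) = ρ

/-- The connectivity graph of a stabilizer code: qubits are connected when they lie in
the support of a common generator. -/
noncomputable def connGraph {n m : ℕ} (S : StabCode n m) : SimpleGraph (Fin n) :=
  SimpleGraph.fromRel fun u v =>
    ∃ i, u ∈ pauliSupp (S.gen i).1 (S.gen i).2 ∧ v ∈ pauliSupp (S.gen i).1 (S.gen i).2

/-- Separators balanced by cardinality yield separators balanced with respect to any nonnegative
weight: keep separating the heavy side, and add the discarded parts to the lighter side. -/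
theorem exists_weighted_separator {V : Type*} [DecidableEq V] {G : SimpleGraph V} {β c K : ℝ}
    (hc : 0 < c) (hK : β + K * (2 / 3) ^ c ≤ K) (hK0 : 0 ≤ K)
    (hsep : HasSepProfile G β c) (w : V → ℝ) (hw : ∀ v, 0 ≤ w v) (W : ℝ) (X : Finset V)
    (hX : ∑ v ∈ X, w v ≤ W) :
    ∃ T U₁ U₂ : Finset V, T ∪ U₁ ∪ U₂ = X ∧
      Disjoint T U₁ ∧ Disjoint T U₂ ∧ Disjoint U₁ U₂ ∧ Disconn G U₁ U₂ ∧
      ∑ v ∈ U₁, w v ≤ 2 / 3 * W ∧ ∑ v ∈ U₂, w v ≤ 2 / 3 * W ∧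
      (T.card : ℝ) ≤ K * (X.card : ℝ) ^ c := by
  induction hN : X.card using Nat.strong_induction_on generalizing X with
  | _ N ih =>
  subst hN
  by_cases hlight : ∑ v ∈ X, w v ≤ 2 / 3 * W
  · refine ⟨∅, X, ∅, by simp, by simp, by simp, by simp, fun _ _ b hb => by simp at hb, hlight,
      ?_, ?_⟩
    · have := Finset.sum_nonneg fun v (_ : v ∈ X) => hw v
      simp only [Finset.sum_empty]
      linarith
    · simp only [Finset.card_empty, Nat.cast_zero]
      positivity
  push Not at hlight
  have hne : X.Nonempty := by
    by_contra h
    rw [Finset.not_nonempty_iff_eq_empty] at h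
    subst h
    simp only [Finset.sum_empty] at hlight hX
    linarith
  have hpos : 0 < X.card := hne.card_pos
  have heavy : ∀ T₀ X₁ X₂ : Finset V, T₀ ∪ X₁ ∪ X₂ = X → Disjoint T₀ X₁ → Disjoint T₀ X₂ →
      Disjoint X₁ X₂ → Disconn G X₁ X₂ → 3 * X₁.card ≤ 2 * X.card →
      (T₀.card : ℝ) ≤ β * (X.card : ℝ) ^ c → 2 / 3 * W < ∑ v ∈ X₁, w v →
      ∃ T U₁ U₂ : Finset V, T ∪ U₁ ∪ U₂ = X ∧
      Disjoint T U₁ ∧ Disjoint T U₂ ∧ Disjoint U₁ U₂ ∧ Disconn G U₁ U₂ ∧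
      ∑ v ∈ U₁, w v ≤ 2 / 3 * W ∧ ∑ v ∈ U₂, w v ≤ 2 / 3 * W ∧
      (T.card : ℝ) ≤ K * (X.card : ℝ) ^ c := by
    intro T₀ X₁ X₂ hun h01 h02 h12 hd hsz hT hh
    have hw0 := Finset.sum_nonneg fun v (_ : v ∈ T₀) => hw v
    have hsum : ∑ v ∈ T₀, w v + ∑ v ∈ X₁, w v + ∑ v ∈ X₂, w v = ∑ v ∈ X, w v := by
      rw [← hun, Finset.sum_union (Finset.disjoint_union_left.2 ⟨h02, h12⟩),
        Finset.sum_union h01]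
    have hw2 := Finset.sum_nonneg fun v (_ : v ∈ X₂) => hw v
    obtain ⟨T, U₁, U₂, hu, hT1, hT2, hU, hUd, hw1', hw2', hTc⟩ :=
      ih X₁.card (by omega) X₁ (by linarith) rfl
    have hsum' : ∑ v ∈ T, w v + ∑ v ∈ U₁, w v + ∑ v ∈ U₂, w v = ∑ v ∈ X₁, w v := by
      rw [← hu, Finset.sum_union (Finset.disjoint_union_left.2 ⟨hT2, hU⟩),
        Finset.sum_union hT1]
    have hwT := Finset.sum_nonneg fun v (_ : v ∈ T) => hw v
    have hcard : ((T₀ ∪ T).card : ℝ) ≤ K * (X.card : ℝ) ^ c := by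
      have h1 : ((T₀ ∪ T).card : ℝ) ≤ T₀.card + T.card := by
        exact_mod_cast Finset.card_union_le _ _
      have h2 : (X₁.card : ℝ) ≤ 2 / 3 * X.card := by
        have : (3 * X₁.card : ℝ) ≤ 2 * X.card := by exact_mod_cast hsz
        linarith
      have h3 : (X₁.card : ℝ) ^ c ≤ (2 / 3) ^ c * (X.card : ℝ) ^ c := by
        rw [← Real.mul_rpow (by norm_num) (by positivity)]
        exact Real.rpow_le_rpow (by positivity) h2 hc.le
      have h4 : (0 : ℝ) ≤ (X.card : ℝ) ^ c := by positivity
      nlinarith [mul_le_mul_of_nonneg_left h3 hK0, mul_le_mul_of_nonneg_right hK h4]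
    subst hu
    simp only [Finset.disjoint_union_left, Finset.disjoint_union_right] at *
    rcases le_total (∑ v ∈ U₁, w v) (∑ v ∈ U₂, w v) with hle | hle
    · refine ⟨T₀ ∪ T, U₁ ∪ X₂, U₂, ?_, ?_, ?_, ?_, ?_, ?_, hw2', hcard⟩
      · rw [← hun]; ext v; simp only [Finset.mem_union]; tauto
      · simp only [Finset.disjoint_union_left, Finset.disjoint_union_right]; tauto
      · simp only [Finset.disjoint_union_left]; tauto
      · simp only [Finset.disjoint_union_left]; exact ⟨hU, h12.2.symm⟩
      · intro a ha b hb hab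
        rcases Finset.mem_union.1 ha with ha | ha
        · exact hUd a ha b hb hab
        · exact hd b (by simp [hb]) a ha hab.symm
      · rw [Finset.sum_union h12.1.2]; linarith
    · refine ⟨T₀ ∪ T, U₁, U₂ ∪ X₂, ?_, ?_, ?_, ?_, ?_, hw1', ?_, hcard⟩
      · rw [← hun]; ext v; simp only [Finset.mem_union]; tauto
      · simp only [Finset.disjoint_union_left]; tauto
      · simp only [Finset.disjoint_union_left, Finset.disjoint_union_right]; tauto
      · simp only [Finset.disjoint_union_right]; exact ⟨hU, h12.1.2⟩
      · intro a ha b hb hab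
        rcases Finset.mem_union.1 hb with hb | hb
        · exact hUd a ha b hb hab
        · exact hd a (by simp [ha]) b hb hab
      · rw [Finset.sum_union h12.2]; linarith
  obtain ⟨T₀, X₁, X₂, hun, h01, h02, h12, hd, hs1, hs2, hT⟩ := hsep X
  by_cases h1 : 2 / 3 * W < ∑ v ∈ X₁, w v
  · exact heavy T₀ X₁ X₂ hun h01 h02 h12 hd hs1 hT h1
  by_cases h2 : 2 / 3 * W < ∑ v ∈ X₂, w v
  · exact heavy T₀ X₂ X₁ (by rw [← hun, Finset.union_right_comm]) h02 h01 h12.symm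
      (fun a ha b hb hab => hd b hb a ha hab.symm) hs2 hT h2
  refine ⟨T₀, X₁, X₂, hun, h01, h02, h12, hd, not_lt.1 h1, not_lt.1 h2, hT.trans ?_⟩
  gcongr
  have : 0 ≤ K * (2 / 3 : ℝ) ^ c := by positivity
  linarith

section CorrectableFamily

variable {V : Type*} [Fintype V] [DecidableEq V] {G : SimpleGraph V} {d : ℕ}
  {F : Set (Finset V)}

theorem IsCorrectableFamily.union_mem (hF : IsCorrectableFamily G d F) {A B : Finset V}
    (hA : A ∈ F) (hB : B ∈ F) (hAB : Disjoint A B) (hd : Disconn G A B) : A ∪ B ∈ F := by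
  have h := hF.2.2.1 2 ![A, B] (by simp [Fin.forall_fin_two, hA, hB]) (by
    have hd' : Disconn G B A := fun b hb a ha hab => hd a ha b hb hab.symm
    simp [Fin.forall_fin_two, hAB, hAB.symm, hd, hd'])
  convert h using 1
  ext v
  simp [Fin.exists_fin_two]

/-- Sets with small outer boundary, relative to their separators, are correctable. -/
theorem IsCorrectableFamily.mem_of_small_outerBoundary (hF : IsCorrectableFamily G d F)
    {β c K : ℝ} (hc : 0 < c) (hK : β + K * (2 / 3) ^ c ≤ K) (hK0 : 0 ≤ K)
    (hsep : HasSepProfile G β c) (H : Finset V)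
    (hH : ((outerBoundary G H).card : ℝ) + K * (H.card : ℝ) ^ c < d) : H ∈ F := by
  induction hN : H.card using Nat.strong_induction_on generalizing H with
  | _ N ih =>
  subst hN
  have hd0 : 0 < d := by
    have : (0 : ℝ) < d := lt_of_le_of_lt (by positivity) hH
    exact_mod_cast this
  rcases H.eq_empty_or_nonempty with rfl | hne
  · exact hF.2.1 _ (by simpa using hd0)
  have hpos : 0 < H.card := hne.card_pos
  obtain ⟨T, U₁, U₂, hun, h1, h2, h12, hd, hs1, hs2, hT⟩ := hsep H
  have hTK : β * (H.card : ℝ) ^ c + K * ((2 / 3) ^ c * (H.card : ℝ) ^ c)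
      ≤ K * (H.card : ℝ) ^ c := by
    have h4 : (0 : ℝ) ≤ (H.card : ℝ) ^ c := by positivity
    nlinarith [mul_le_mul_of_nonneg_right hK h4]
  have sub : ∀ X₁ X₂ : Finset V, T ∪ X₁ ∪ X₂ = H → Disconn G X₁ X₂ →
      3 * X₁.card ≤ 2 * H.card → X₁ ∈ F := by
    intro X₁ X₂ hu hdis hs
    refine ih X₁.card (by omega) X₁ ?_ rfl
    have hb : outerBoundary G X₁ ⊆ outerBoundary G H ∪ T := by
      intro v hv
      simp only [outerBoundary, Finset.mem_filter, Finset.mem_univ, true_and,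
        Finset.mem_union, ← hu] at hv ⊢
      obtain ⟨hv, u, hu', hadj⟩ := hv
      have := fun h => hdis u hu' v h hadj
      by_cases hvT : v ∈ T
      · exact .inr hvT
      · exact .inl ⟨by tauto, u, by tauto, hadj⟩
    have h0 : ((outerBoundary G X₁).card : ℝ) ≤ (outerBoundary G H).card + T.card := by
      exact_mod_cast (Finset.card_le_card hb).trans (Finset.card_union_le _ _)
    have h2 : (X₁.card : ℝ) ≤ 2 / 3 * H.card := by
      have : (3 * X₁.card : ℝ) ≤ 2 * H.card := by exact_mod_cast hs
      linarith
    have h3 : (X₁.card : ℝ) ^ c ≤ (2 / 3) ^ c * (H.card : ℝ) ^ c := by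
      rw [← Real.mul_rpow (by norm_num) (by positivity)]
      exact Real.rpow_le_rpow (by positivity) h2 hc.le
    have := mul_le_mul_of_nonneg_left h3 hK0
    linarith
  have hU₁ := sub U₁ U₂ hun hd hs1
  have hU₂ := sub U₂ U₁ (by rw [← hun, Finset.union_right_comm])
    (fun a ha b hb hab => hd b hb a ha hab.symm) hs2
  have hTF : T ∪ outerBoundary G H ∈ F := by
    refine hF.2.1 _ ?_
    have h0 : ((T ∪ outerBoundary G H).card : ℝ) ≤ T.card + (outerBoundary G H).card := by
      exact_mod_cast Finset.card_union_le _ _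
    have : (0 : ℝ) ≤ K * ((2 / 3) ^ c * (H.card : ℝ) ^ c) := by positivity
    have : ((T ∪ outerBoundary G H).card : ℝ) < d := by linarith
    exact_mod_cast this
  have hall := hF.2.2.2 _ (hF.union_mem hU₁ hU₂ h12 hd) _ hTF (by
    intro v hv
    simp only [outerBoundary, Finset.mem_filter, Finset.mem_univ, true_and,
      Finset.mem_union, ← hun] at hv ⊢
    obtain ⟨hv, u, hu', hadj⟩ := hv
    by_cases hvT : v ∈ T
    · exact .inl hvT
    · exact .inr ⟨by tauto, u, by tauto, hadj⟩)
  refine hF.1 _ hall H ?_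
  intro v hv
  rw [← hun] at hv
  simp only [Finset.mem_union] at hv ⊢
  tauto

/-- Recursive separation into pieces of size `< d` removes few vertices. -/
theorem IsCorrectableFamily.exists_mem_of_separators (hF : IsCorrectableFamily G d F)
    {β c L : ℝ} (hc1 : c < 1) (hd : 0 < d)
    (hL0 : 0 ≤ L) (hL : β + L ≤ L * (2 / 3) ^ (c - 1))
    (hsep : HasSepProfile G β c) (H : Finset V) (x : ℝ) (hxH : (H.card : ℝ) ≤ x)
    (hxd : 2 / 3 * (d : ℝ) ≤ x) :
    ∃ B ⊆ H, B ∈ F ∧ ((H \ B).card : ℝ) ≤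
      H.card * (L * (2 / 3 * (d : ℝ)) ^ (c - 1) - L * x ^ (c - 1)) := by
  induction hN : H.card using Nat.strong_induction_on generalizing H x with
  | _ N ih =>
  subst hN
  have hd' : (0 : ℝ) < d := by exact_mod_cast hd
  have anti : ∀ {y z : ℝ}, 0 < y → y ≤ z → L * z ^ (c - 1) ≤ L * y ^ (c - 1) := fun hy hyz =>
    mul_le_mul_of_nonneg_left (Real.rpow_le_rpow_of_nonpos hy hyz (by linarith)) hL0
  rcases lt_or_ge H.card d with hlt | hge
  · refine ⟨H, subset_rfl, hF.2.1 _ hlt, ?_⟩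
    have := anti (by positivity) hxd
    simp only [sdiff_self, Finset.bot_eq_empty, Finset.card_empty, Nat.cast_zero]
    exact mul_nonneg (by positivity) (by linarith)
  have hge' : (d : ℝ) ≤ H.card := by exact_mod_cast hge
  have hpos : (0 : ℝ) < H.card := by linarith
  obtain ⟨T, U₁, U₂, hun, h1, h2, h12, hdis, hs1, hs2, hT⟩ := hsep H
  have hs1' : (3 * U₁.card : ℝ) ≤ 2 * H.card := by exact_mod_cast hs1
  have hs2' : (3 * U₂.card : ℝ) ≤ 2 * H.card := by exact_mod_cast hs2
  obtain ⟨B₁, hB₁, hF₁, hc₁⟩ := ih U₁.card (by omega) U₁ (2 / 3 * H.card)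
    (by linarith) (by linarith) rfl
  obtain ⟨B₂, hB₂, hF₂, hc₂⟩ := ih U₂.card (by omega) U₂ (2 / 3 * H.card)
    (by linarith) (by linarith) rfl
  refine ⟨B₁ ∪ B₂, ?_, hF.union_mem hF₁ hF₂ (h12.mono hB₁ hB₂)
    (fun a ha b hb => hdis a (hB₁ ha) b (hB₂ hb)), ?_⟩
  · rw [← hun]
    exact Finset.union_subset
      (hB₁.trans (Finset.subset_union_right.trans Finset.subset_union_left))
      (hB₂.trans Finset.subset_union_right)
  have hcov : H \ (B₁ ∪ B₂) ⊆ T ∪ (U₁ \ B₁) ∪ (U₂ \ B₂) := by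
    rw [← hun]
    intro v
    simp only [Finset.mem_union, Finset.mem_sdiff]
    tauto
  have hcard : ((H \ (B₁ ∪ B₂)).card : ℝ) ≤ T.card + (U₁ \ B₁).card + (U₂ \ B₂).card := by
    exact_mod_cast (Finset.card_le_card hcov).trans ((Finset.card_union_le _ _).trans
      (Nat.add_le_add_right (Finset.card_union_le _ _) _))
  have hUU : (U₁.card : ℝ) + U₂.card ≤ H.card := by
    have : U₁.card + U₂.card ≤ H.card := by
      rw [← Finset.card_union_of_disjoint h12, ← hun]
      exact Finset.card_le_card (Finset.union_subset
        (Finset.subset_union_right.trans Finset.subset_union_left) Finset.subset_union_right)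
    exact_mod_cast this
  set h : ℝ := (H.card : ℝ) with hh
  set g : ℝ := L * (2 / 3 * (d : ℝ)) ^ (c - 1) - L * (2 / 3 * h) ^ (c - 1) with hg
  have hg0 : 0 ≤ g := by
    have := anti (y := 2 / 3 * (d : ℝ)) (z := 2 / 3 * h) (by positivity) (by linarith)
    linarith
  have hpow : h ^ c = h * h ^ (c - 1) := by
    rw [Real.rpow_sub_one hpos.ne']
    field_simp
  have hp : 0 ≤ h ^ (c - 1) := by positivity
  have hstep : β * h ^ (c - 1) + L * h ^ (c - 1) ≤ L * (2 / 3 * h) ^ (c - 1) := by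
    rw [Real.mul_rpow (by norm_num) hpos.le]
    nlinarith [mul_le_mul_of_nonneg_right hL hp]
  have hx := anti hpos hxH
  calc ((H \ (B₁ ∪ B₂)).card : ℝ) ≤ T.card + (U₁ \ B₁).card + (U₂ \ B₂).card := hcard
    _ ≤ β * h ^ c + (U₁.card + U₂.card) * g := by linarith
    _ ≤ β * h ^ c + h * g := by gcongr
    _ = h * (β * h ^ (c - 1) + g) := by rw [hpow]; ring
    _ ≤ h * (L * (2 / 3 * (d : ℝ)) ^ (c - 1) - L * x ^ (c - 1)) := by
        refine mul_le_mul_of_nonneg_left ?_ hpos.le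
        linarith

end CorrectableFamily

/-- The bound on the total weight is preserved when a region is split. -/
theorem potential_step {W y z δ q : ℝ} (hW : 0 ≤ W) (hy : 0 ≤ y) (hδ : 0 ≤ δ) (hq : 0 < q)
    (hδq : 2 * δ * q ≤ q - 1) (hzy : z ≤ y) :
    (W + δ * (W * y)) * (2 - y) ≤ W * (2 - z / q) := by
  have h1 : z / q ≤ y / q := by gcongr
  have h2 : y / q ≤ y - 2 * δ * y := by
    rw [div_le_iff₀ hq]
    nlinarith
  have h3 : (W + δ * (W * y)) * (2 - y) = W * ((1 + δ * y) * (2 - y)) := by ring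
  rw [h3]
  refine mul_le_mul_of_nonneg_left ?_ hW
  nlinarith [mul_nonneg hδ (mul_nonneg hy hy)]

section Regions

variable {V : Type*} [Fintype V] [DecidableEq V] {G : SimpleGraph V} {d : ℕ}
  {F : Set (Finset V)}

/-- Splitting a region `R` with boundary `B` along a separator `T` gives regions again. -/
theorem outerBoundary_split_subset {R B T U₁ U₂ : Finset V} (hBR : B ⊆ R)
    (hun : T ∪ U₁ ∪ U₂ = R) (hd : Disconn G U₁ U₂)
    (hB : outerBoundary G (R \ B) ⊆ B) :
    outerBoundary G ((U₁ ∪ T) \ (B ∩ U₁ ∪ T)) ⊆ B ∩ U₁ ∪ T := by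
  intro v hv
  simp only [outerBoundary, Finset.mem_filter, Finset.mem_univ, true_and, Finset.mem_sdiff,
    Finset.mem_union, Finset.mem_inter] at hv
  obtain ⟨hv, u, ⟨huU, huB⟩, hadj⟩ := hv
  have huT : u ∉ T := by tauto
  have hu₁ : u ∈ U₁ := by tauto
  have huB' : u ∉ B := by tauto
  have hvR : v ∈ R := by
    by_contra hvR
    exact hvR (hBR (hB (by
      simp only [outerBoundary, Finset.mem_filter, Finset.mem_univ, true_and, Finset.mem_sdiff]
      exact ⟨by tauto, u, ⟨by rw [← hun]; simp [hu₁], huB'⟩, hadj⟩)))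
  have hv₂ : v ∉ U₂ := fun h => hd u hu₁ v h hadj
  simp only [← hun, Finset.mem_union, Finset.mem_inter] at hvR ⊢
  tauto

/-- The interior of a region of small weight is correctable. -/
theorem IsCorrectableFamily.exists_mem_of_light_region (hF : IsCorrectableFamily G d F)
    {β c K t r q : ℝ} (hc : 0 < c) (hc1 : c < 1) (hK : β + K * (2 / 3) ^ c ≤ K)
    (hK0 : 0 ≤ K) (hsep : HasSepProfile G β c) (ht : 0 < t) (hr : 0 < r)
    (hq : q = (4 / 3) ^ (1 - c)) (hleaf : r / t + K * r ^ c < d)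
    (R B : Finset V) (hBR : B ⊆ R) (hB : outerBoundary G (R \ B) ⊆ B)
    (hWr : (R.card : ℝ) + t * B.card ≤ r) (x : ℝ) (hxr : 3 / 4 * r ≤ x) :
    ∃ A ⊆ R \ B, A ∈ F ∧
      t * ((R \ A).card : ℝ) ≤ (R.card + t * B.card) * (2 - (r / x) ^ (1 - c) / q) := by
  have hc1' : 0 < 1 - c := by linarith
  have hq0 : 0 < q := by rw [hq]; positivity
  have hx0 : 0 < x := by linarith
  refine ⟨R \ B, subset_rfl, ?_, ?_⟩
  · refine hF.mem_of_small_outerBoundary hc hK hK0 hsep _ (lt_of_le_of_lt ?_ hleaf)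
    have h1 : ((outerBoundary G (R \ B)).card : ℝ) ≤ B.card := by
      exact_mod_cast Finset.card_le_card hB
    have h2 : (B.card : ℝ) ≤ r / t := by
      rw [le_div_iff₀ ht]
      have : (0 : ℝ) ≤ R.card := by positivity
      linarith
    have h3 : ((R \ B).card : ℝ) ≤ r := by
      have h4 : ((R \ B).card : ℝ) ≤ R.card := by
        exact_mod_cast Finset.card_le_card Finset.sdiff_subset
      have : (0 : ℝ) ≤ t * B.card := by positivity
      linarith
    have h5 := Real.rpow_le_rpow (by positivity) h3 hc.le
    have := mul_le_mul_of_nonneg_left h5 hK0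
    linarith
  · have h1 : R \ (R \ B) = B := Finset.sdiff_sdiff_eq_self hBR
    have h2 : (r / x) ^ (1 - c) / q ≤ 1 := by
      rw [div_le_one hq0, hq]
      refine Real.rpow_le_rpow (by positivity) ?_ hc1'.le
      rw [div_le_iff₀ hx0]
      linarith
    rw [h1]
    have h3 : (0 : ℝ) ≤ R.card := by positivity
    have h4 : (0 : ℝ) ≤ t * B.card := by positivity
    nlinarith [mul_nonneg (add_nonneg h3 h4) (sub_nonneg.2 h2)]

/-- Recursive separation of a region, balanced with respect to the weight that counts boundary
vertices with additional weight `t`, until the interiors are correctable. -/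
theorem IsCorrectableFamily.exists_mem_of_weighted_separators (hF : IsCorrectableFamily G d F)
    {β c K t r q δ : ℝ} (hc : 0 < c) (hc1 : c < 1) (hK : β + K * (2 / 3) ^ c ≤ K)
    (hK0 : 0 ≤ K) (hsep : HasSepProfile G β c) (ht : 0 < t) (hr : 0 < r)
    (hq : q = (4 / 3) ^ (1 - c)) (hδ : δ ≤ 1 / 6) (hδq : 2 * δ * q ≤ q - 1)
    (hδ0 : 0 ≤ δ) (htr : 2 * (1 + t) * K ≤ δ * r ^ (1 - c)) (hleaf : r / t + K * r ^ c < d)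
    (N : ℕ) (R B : Finset V) (hBR : B ⊆ R) (hB : outerBoundary G (R \ B) ⊆ B)
    (hW : (R.card : ℝ) + t * B.card ≤ r * (4 / 3) ^ N)
    (x : ℝ) (hxW : (R.card : ℝ) + t * B.card ≤ x) (hxr : 3 / 4 * r ≤ x) :
    ∃ A ⊆ R \ B, A ∈ F ∧
      t * ((R \ A).card : ℝ) ≤ (R.card + t * B.card) * (2 - (r / x) ^ (1 - c) / q) := by
  have hc1' : 0 < 1 - c := by linarith
  have hq0 : 0 < q := by rw [hq]; positivity
  induction N generalizing R B x with
  | zero =>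
    exact hF.exists_mem_of_light_region hc hc1 hK hK0 hsep ht hr hq hleaf R B hBR hB
      (by simpa using hW) x hxr
  | succ N ih =>
  rcases le_or_gt ((R.card : ℝ) + t * B.card) r with hWr | hWr
  · exact hF.exists_mem_of_light_region hc hc1 hK hK0 hsep ht hr hq hleaf R B hBR hB hWr x hxr
  obtain ⟨T, U₁, U₂, hun, -, -, h12, hd, hw1, hw2, hTc⟩ :=
    exists_weighted_separator hc hK hK0 hsep (fun v => 1 + if v ∈ B then t else 0)
      (fun v => by positivity) (R.card + t * B.card) R (by
        rw [Finset.sum_add_distrib, ← Finset.sum_filter, Finset.filter_mem_eq_inter,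
          Finset.inter_eq_right.2 hBR]
        simp [mul_comm])
  have hsum : ∀ U : Finset V, ∑ v ∈ U, (1 + if v ∈ B then t else 0)
      = (U.card : ℝ) + t * (B ∩ U).card := fun U => by
    rw [Finset.sum_add_distrib, ← Finset.sum_filter, Finset.filter_mem_eq_inter,
      Finset.inter_comm]
    simp [mul_comm]
  rw [hsum] at hw1 hw2
  set W : ℝ := (R.card : ℝ) + t * B.card with hWdef
  have hW0 : 0 < W := by linarith
  set y : ℝ := (r / W) ^ (1 - c) with hy
  have hy0 : 0 ≤ y := by positivity
  have hy1 : y ≤ 1 := Real.rpow_le_one (by positivity) (by rw [div_le_one hW0]; exact hWr.le) hc1'.le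
  have hyW : r ^ (1 - c) * W ^ c = W * y := by
    rw [hy, Real.div_rpow hr.le hW0.le, Real.rpow_sub hW0, Real.rpow_one]
    field_simp
  have hRW : (R.card : ℝ) ^ c ≤ W ^ c := by
    refine Real.rpow_le_rpow (by positivity) ?_ hc.le
    have : 0 ≤ t * (B.card : ℝ) := by positivity
    linarith
  have hTW : 2 * (1 + t) * (T.card : ℝ) ≤ δ * (W * y) := by
    rw [← hyW]
    calc 2 * (1 + t) * (T.card : ℝ) ≤ 2 * (1 + t) * (K * W ^ c) := by
          refine mul_le_mul_of_nonneg_left (hTc.trans ?_) (by positivity)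
          gcongr
      _ = 2 * (1 + t) * K * W ^ c := by ring
      _ ≤ δ * r ^ (1 - c) * W ^ c := by gcongr
      _ = δ * (r ^ (1 - c) * W ^ c) := by ring
  have hTW' : (1 + t) * (T.card : ℝ) ≤ 1 / 12 * W := by
    have h1 : W * y ≤ W := mul_le_of_le_one_right hW0.le hy1
    have h2 := mul_le_mul hδ h1 (by positivity) (by norm_num)
    linarith
  have hcardle : ∀ U : Finset V, ((U ∪ T).card : ℝ) + t * (B ∩ U ∪ T).card
      ≤ U.card + t * (B ∩ U).card + (1 + t) * T.card := by
    intro U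
    have h1 : ((U ∪ T).card : ℝ) ≤ U.card + T.card := by
      exact_mod_cast Finset.card_union_le _ _
    have h2 : ((B ∩ U ∪ T).card : ℝ) ≤ (B ∩ U).card + T.card := by
      exact_mod_cast Finset.card_union_le _ _
    have h3 := mul_le_mul_of_nonneg_left h2 ht.le
    linarith
  have sub : ∀ X₁ X₂ : Finset V, T ∪ X₁ ∪ X₂ = R → Disconn G X₁ X₂ →
      (X₁.card : ℝ) + t * (B ∩ X₁).card ≤ 2 / 3 * W →
      ∃ A ⊆ X₁, A ⊆ R \ B ∧ A ∈ F ∧ t * (((X₁ ∪ T) \ A).card : ℝ) ≤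
        (X₁.card + t * (B ∩ X₁).card + (1 + t) * T.card) * (2 - y) := by
    intro X₁ X₂ hu hdd hwX
    have hW1 := hcardle X₁
    have hW2 : ((X₁ ∪ T).card : ℝ) + t * (B ∩ X₁ ∪ T).card ≤ 3 / 4 * W := by linarith
    have hyq : (r / (3 / 4 * W)) ^ (1 - c) / q = y := by
      rw [hq, hy, ← Real.div_rpow (by positivity) (by positivity)]
      congr 1
      field_simp
    have hN : ((X₁ ∪ T).card : ℝ) + t * (B ∩ X₁ ∪ T).card ≤ r * (4 / 3) ^ N := by
      rw [pow_succ] at hW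
      linarith
    have key : ∃ A ⊆ (X₁ ∪ T) \ (B ∩ X₁ ∪ T), A ∈ F ∧ t * (((X₁ ∪ T) \ A).card : ℝ) ≤
        ((X₁ ∪ T).card + t * (B ∩ X₁ ∪ T).card) * (2 - (r / (3 / 4 * W)) ^ (1 - c) / q) :=
      ih _ _ (Finset.union_subset_union_left Finset.inter_subset_right)
        (outerBoundary_split_subset hBR hu hdd hB) hN _ hW2 (by linarith)
    obtain ⟨A, hA, hAF, hAc⟩ := key
    rw [hyq] at hAc
    have hA' : ∀ v ∈ A, v ∈ X₁ ∧ v ∉ B := by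
      intro v hv
      have := hA hv
      simp only [Finset.mem_sdiff, Finset.mem_union, Finset.mem_inter] at this
      tauto
    refine ⟨A, fun v hv => (hA' v hv).1, fun v hv => ?_, hAF, hAc.trans ?_⟩
    · rw [← hu]
      simp [hA' v hv]
    · exact mul_le_mul_of_nonneg_right hW1 (by linarith)
  obtain ⟨A₁, hA₁, hA₁', hF₁, hc₁⟩ := sub U₁ U₂ hun hd hw1
  obtain ⟨A₂, hA₂, hA₂', hF₂, hc₂⟩ := sub U₂ U₁ (by rw [← hun, Finset.union_right_comm])
    (fun a ha b hb hab => hd b hb a ha hab.symm) hw2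
  refine ⟨A₁ ∪ A₂, Finset.union_subset hA₁' hA₂', hF.union_mem hF₁ hF₂ (h12.mono hA₁ hA₂)
    (fun a ha b hb => hd a (hA₁ ha) b (hA₂ hb)), ?_⟩
  have hcov : R \ (A₁ ∪ A₂) ⊆ ((U₁ ∪ T) \ A₁) ∪ ((U₂ ∪ T) \ A₂) := by
    rw [← hun]
    intro v
    simp only [Finset.mem_union, Finset.mem_sdiff]
    tauto
  have hcard : ((R \ (A₁ ∪ A₂)).card : ℝ) ≤ ((U₁ ∪ T) \ A₁).card + ((U₂ ∪ T) \ A₂).card := by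
    exact_mod_cast (Finset.card_le_card hcov).trans (Finset.card_union_le _ _)
  have hUU : (U₁.card : ℝ) + U₂.card ≤ R.card := by
    have : U₁.card + U₂.card ≤ R.card := by
      rw [← Finset.card_union_of_disjoint h12, ← hun]
      exact Finset.card_le_card (Finset.union_subset
        (Finset.subset_union_right.trans Finset.subset_union_left) Finset.subset_union_right)
    exact_mod_cast this
  have hBB : ((B ∩ U₁).card : ℝ) + (B ∩ U₂).card ≤ B.card := by
    have : (B ∩ U₁).card + (B ∩ U₂).card ≤ B.card := by
      rw [← Finset.card_union_of_disjoint
        (h12.mono Finset.inter_subset_right Finset.inter_subset_right)]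
      exact Finset.card_le_card (Finset.union_subset Finset.inter_subset_left
        Finset.inter_subset_left)
    exact_mod_cast this
  have hxy : (r / x) ^ (1 - c) ≤ y :=
    Real.rpow_le_rpow (by have : 0 < x := hW0.trans_le hxW
                          positivity)
      (div_le_div_of_nonneg_left hr.le hW0 hxW) hc1'.le
  calc t * ((R \ (A₁ ∪ A₂)).card : ℝ)
      ≤ t * (((U₁ ∪ T) \ A₁).card + ((U₂ ∪ T) \ A₂).card) := by gcongr
    _ ≤ ((U₁.card + U₂.card) + t * ((B ∩ U₁).card + (B ∩ U₂).card)
          + 2 * (1 + t) * T.card) * (2 - y) := by linarith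
    _ ≤ (R.card + t * B.card + δ * (W * y)) * (2 - y) := by
        refine mul_le_mul_of_nonneg_right ?_ (by linarith)
        gcongr
    _ ≤ W * (2 - (r / x) ^ (1 - c) / q) :=
        potential_step hW0.le hy0 hδ0 hq0 hδq hxy

end Regions

theorem IsCorrectableFamily.empty_mem {V : Type*} [Fintype V] [DecidableEq V]
    {G : SimpleGraph V} {d : ℕ} {F : Set (Finset V)} (hF : IsCorrectableFamily G d F) :
    ∅ ∈ F := by
  simpa using hF.2.2.1 0 (fun _ => ∅) (fun i => i.elim0) (fun i => i.elim0)

/-- A graph with separation profile `O(r^c)` splits into two correctable sets and a small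
remainder. -/
theorem exists_correctable_partition (β c : ℝ) (hβ : 1 ≤ β) (hc0 : 0 < c) (hc1 : c < 1) :
    ∃ α : ℝ, 0 < α ∧ ∀ (n d : ℕ) (G : SimpleGraph (Fin n)) (F : Set (Finset (Fin n))),
      IsCorrectableFamily G d F → HasSepProfile G β c →
      ∃ A ∈ F, ∃ B ∈ F, (((Finset.univ \ A) \ B).card : ℝ) * (d : ℝ) ^ ((1 - c ^ 2) / c)
        ≤ α * n := by
  have hc1' : 0 < 1 - c := by linarith
  have hp1 : ((2 : ℝ) / 3) ^ c < 1 := Real.rpow_lt_one (by norm_num) (by norm_num) hc0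
  have hp2 : 1 < ((2 : ℝ) / 3) ^ (c - 1) :=
    Real.one_lt_rpow_of_pos_of_lt_one_of_neg (by norm_num) (by norm_num) (by linarith)
  obtain ⟨q, hq⟩ : ∃ q : ℝ, q = (4 / 3) ^ (1 - c) := ⟨_, rfl⟩
  have hq1 : 1 < q := by rw [hq]; exact Real.one_lt_rpow (by norm_num) hc1'
  obtain ⟨δ, hδ0, hδ, hδq⟩ : ∃ δ : ℝ, 0 < δ ∧ δ ≤ 1 / 6 ∧ 2 * δ * q ≤ q - 1 := by
    refine ⟨min (1 / 6) ((q - 1) / (2 * q)), ?_, min_le_left _ _, ?_⟩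
    · have : 0 < q - 1 := by linarith
      positivity
    · have h := min_le_right (1 / 6) ((q - 1) / (2 * q))
      rw [le_div_iff₀ (by linarith)] at h
      linarith
  obtain ⟨K, hK0, hK⟩ : ∃ K : ℝ, 0 < K ∧ β + K * (2 / 3) ^ c ≤ K := by
    have h : 0 < 1 - ((2 : ℝ) / 3) ^ c := by linarith
    refine ⟨β / (1 - (2 / 3) ^ c), by positivity, le_of_eq ?_⟩
    field_simp
    ring
  obtain ⟨L, hL0, hL⟩ : ∃ L : ℝ, 0 < L ∧ β + L ≤ L * (2 / 3) ^ (c - 1) := by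
    have h : 0 < ((2 : ℝ) / 3) ^ (c - 1) - 1 := by linarith
    refine ⟨β / ((2 / 3) ^ (c - 1) - 1), by positivity, le_of_eq ?_⟩
    field_simp
    ring
  obtain ⟨E, hE⟩ : ∃ E : ℝ, E = 4 * K / δ + K := ⟨_, rfl⟩
  have hE0 : 0 < E := by rw [hE]; positivity
  obtain ⟨κ, hκ⟩ : ∃ κ : ℝ, κ = δ / (4 * K) * (1 / (2 * E)) ^ ((1 - c) / c) := ⟨_, rfl⟩
  have hκ0 : 0 < κ := by rw [hκ]; positivity
  refine ⟨2 * (L * (2 / 3) ^ (c - 1)) / κ + (1 / κ) ^ (1 + c), by positivity, ?_⟩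
  intro n d G F hF hsep
  obtain ⟨D, hD⟩ : ∃ D : ℝ, D = (d : ℝ) ^ ((1 - c) / c) := ⟨_, rfl⟩
  have hD0 : 0 ≤ D := by rw [hD]; positivity
  rcases lt_or_ge (κ * D) 1 with hsmall | hlarge
  · refine ⟨∅, hF.empty_mem, ∅, hF.empty_mem, ?_⟩
    have h1 : (d : ℝ) ^ ((1 - c ^ 2) / c) ≤ (1 / κ) ^ (1 + c) := by
      have h2 : (1 - c ^ 2) / c = (1 - c) / c * (1 + c) := by ring
      rw [h2, Real.rpow_mul (by positivity), ← hD]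
      refine Real.rpow_le_rpow hD0 ?_ (by linarith)
      rw [le_div_iff₀ hκ0]
      linarith
    have h3 : 0 ≤ 2 * (L * (2 / 3) ^ (c - 1)) / κ := by positivity
    simp only [Finset.sdiff_empty, Finset.card_univ, Fintype.card_fin]
    nlinarith [mul_le_mul_of_nonneg_left (h1.trans (le_add_of_nonneg_left h3))
      (Nat.cast_nonneg (α := ℝ) n)]
  have hd : 0 < d := by
    rcases Nat.eq_zero_or_pos d with rfl | h
    · rw [hD, Nat.cast_zero, Real.zero_rpow (by positivity)] at hlarge
      linarith
    · exact h
  have hd' : (0 : ℝ) < d := by exact_mod_cast hd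
  obtain ⟨r, hr⟩ : ∃ r : ℝ, r = (d / (2 * E)) ^ (1 / c) := ⟨_, rfl⟩
  have hr0 : 0 < r := by rw [hr]; positivity
  have hrc : r ^ c = d / (2 * E) := by
    rw [hr, ← Real.rpow_mul (by positivity), one_div_mul_cancel hc0.ne', Real.rpow_one]
  have hrc1 : δ * r ^ (1 - c) = 4 * (κ * D) * K := by
    have h1 : r ^ (1 - c) = D * (1 / (2 * E)) ^ ((1 - c) / c) := by
      rw [hr, ← Real.rpow_mul (by positivity), hD, ← Real.mul_rpow hd'.le (by positivity)]
      congr 1 <;> ring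
    rw [h1, hκ]
    field_simp
  have hrt : r / (κ * D) = 4 * K / δ * r ^ c := by
    have h1 : r = r ^ (1 - c) * r ^ c := by
      rw [← Real.rpow_add hr0, sub_add_cancel, Real.rpow_one]
    have h2 : 0 < κ * D := by linarith
    rw [div_eq_iff h2.ne']
    calc r = r ^ (1 - c) * r ^ c := h1
      _ = δ * r ^ (1 - c) * r ^ c / δ := by field_simp
      _ = _ := by rw [hrc1]; ring
  obtain ⟨N, hN⟩ : ∃ N : ℕ, (n : ℝ) ≤ r * (4 / 3) ^ N := by
    obtain ⟨N, hN⟩ := pow_unbounded_of_one_lt ((n : ℝ) / r) (show (1 : ℝ) < 4 / 3 by norm_num)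
    refine ⟨N, ?_⟩
    rw [div_lt_iff₀ hr0] at hN
    linarith
  obtain ⟨A, -, hA, hAc⟩ := hF.exists_mem_of_weighted_separators hc0 hc1 hK hK0.le hsep
    (t := κ * D) (by linarith) hr0 hq hδ hδq hδ0.le
    (by rw [hrc1]; nlinarith)
    (by
      rw [hrt, ← add_mul, ← hE, hrc]
      have : E * (d / (2 * E)) = d / 2 := by field_simp
      rw [this]
      linarith)
    N Finset.univ ∅ (Finset.empty_subset _) (by
      intro v hv
      simp [outerBoundary] at hv) (by simpa using hN) (max n (3 / 4 * r))
    (by simp) (le_max_right _ _)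
  obtain ⟨B, -, hB, hBc⟩ := hF.exists_mem_of_separators hc1 hd hL0.le hL hsep
    (Finset.univ \ A) (max ((Finset.univ \ A).card : ℝ) (2 / 3 * d)) (le_max_left _ _)
    (le_max_right _ _)
  refine ⟨A, hA, B, hB, ?_⟩
  have hAc' : κ * D * ((Finset.univ \ A).card : ℝ) ≤ n * 2 := by
    refine hAc.trans ?_
    simp only [Finset.card_univ, Fintype.card_fin, Finset.card_empty, Nat.cast_zero, mul_zero,
      add_zero]
    refine mul_le_mul_of_nonneg_left ?_ (by positivity)
    have hx : 0 < max (n : ℝ) (3 / 4 * r) := lt_max_of_lt_right (by positivity)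
    have : 0 ≤ (r / max (n : ℝ) (3 / 4 * r)) ^ (1 - c) / q := by positivity
    linarith
  set h : ℝ := ((Finset.univ \ A).card : ℝ) with hh
  have hBc' : (((Finset.univ \ A) \ B).card : ℝ) ≤
      h * (L * (2 / 3) ^ (c - 1) * (d : ℝ) ^ (c - 1)) := by
    refine hBc.trans (mul_le_mul_of_nonneg_left ?_ (by positivity))
    rw [Real.mul_rpow (by norm_num) hd'.le]
    have : 0 ≤ L * max h (2 / 3 * (d : ℝ)) ^ (c - 1) := by positivity
    linarith
  have hexp : (d : ℝ) ^ ((1 - c ^ 2) / c) = D * (d : ℝ) ^ (1 - c) := by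
    rw [hD, ← Real.rpow_add hd']
    congr 1
    field_simp
    ring
  have hdd : (d : ℝ) ^ (c - 1) * (d : ℝ) ^ (1 - c) = 1 := by
    rw [← Real.rpow_add hd']
    simp
  calc (((Finset.univ \ A) \ B).card : ℝ) * (d : ℝ) ^ ((1 - c ^ 2) / c)
      ≤ h * (L * (2 / 3) ^ (c - 1) * (d : ℝ) ^ (c - 1)) * (d : ℝ) ^ ((1 - c ^ 2) / c) := by
        gcongr
    _ = L * (2 / 3) ^ (c - 1) / κ * (κ * D * h) * ((d : ℝ) ^ (c - 1) * (d : ℝ) ^ (1 - c)) := by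
        rw [hexp]
        field_simp
    _ ≤ L * (2 / 3) ^ (c - 1) / κ * (n * 2) := by
        rw [hdd, mul_one]
        gcongr
    _ = 2 * (L * (2 / 3) ^ (c - 1)) / κ * n := by ring
    _ ≤ _ := by
        gcongr
        have : 0 ≤ (1 / κ) ^ (1 + c) := by positivity
        linarith

theorem neg_one_pow_val_add (x y : ZMod 2) :
    (-1 : ℂ) ^ (x + y).val = (-1) ^ x.val * (-1) ^ y.val := by
  rw [ZMod.val_add, ← neg_one_pow_eq_pow_mod_two, pow_add]

theorem neg_one_pow_sum_val {ι : Type*} (s : Finset ι) (f : ι → ZMod 2) :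
    (-1 : ℂ) ^ (∑ i ∈ s, (f i).val) = (-1) ^ (∑ i ∈ s, f i).val := by
  induction s using Finset.cons_induction with
  | empty => simp
  | cons a s ha ih => rw [Finset.sum_cons, Finset.sum_cons, pow_add, ih, neg_one_pow_val_add]

theorem zmod_two_eq_one {x : ZMod 2} (hx : x ≠ 0) : x = 1 := by
  fin_cases x
  · exact absurd rfl hx
  · rfl

/-- The symplectic form on Pauli labels, which measures commutation. -/
def sympForm (n : ℕ) : LinearMap.BilinForm (ZMod 2) (QIdx n × QIdx n) :=
  LinearMap.mk₂ (ZMod 2) (fun x y => ∑ k, (x.1 k * y.2 k + y.1 k * x.2 k))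
    (fun x x' y => by
      rw [← Finset.sum_add_distrib]
      exact Finset.sum_congr rfl fun k _ => by
        simp only [Prod.fst_add, Prod.snd_add, Pi.add_apply]; ring)
    (fun a x y => by
      rw [smul_eq_mul, Finset.mul_sum]
      exact Finset.sum_congr rfl fun k _ => by
        simp only [Prod.smul_fst, Prod.smul_snd, Pi.smul_apply, smul_eq_mul]; ring)
    (fun x y y' => by
      rw [← Finset.sum_add_distrib]
      exact Finset.sum_congr rfl fun k _ => by
        simp only [Prod.fst_add, Prod.snd_add, Pi.add_apply]; ring)
    (fun a x y => by
      rw [smul_eq_mul, Finset.mul_sum]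
      exact Finset.sum_congr rfl fun k _ => by
        simp only [Prod.smul_fst, Prod.smul_snd, Pi.smul_apply, smul_eq_mul]; ring)

theorem sympForm_apply {n : ℕ} (x y : QIdx n × QIdx n) :
    sympForm n x y = ∑ k, (x.1 k * y.2 k + y.1 k * x.2 k) := rfl

theorem sympForm_comm {n : ℕ} (x y : QIdx n × QIdx n) : sympForm n x y = sympForm n y x := by
  simp only [sympForm_apply]
  exact Finset.sum_congr rfl fun k _ => add_comm _ _

theorem sympForm_isRefl (n : ℕ) : (sympForm n).IsRefl := fun x y h => by
  rw [sympForm_comm]; exact h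

theorem exists_sympForm_ne_zero {n : ℕ} {x : QIdx n × QIdx n} (hx : x ≠ 0) :
    ∃ y, sympForm n x y ≠ 0 := by
  by_contra! h
  apply hx
  ext i
  · simpa [sympForm_apply, Pi.single_apply, Finset.sum_add_distrib] using h (0, Pi.single i 1)
  · simpa [sympForm_apply, Pi.single_apply, Finset.sum_add_distrib] using h (Pi.single i 1, 0)

theorem sympForm_nondegenerate (n : ℕ) : (sympForm n).Nondegenerate := by
  refine (LinearMap.IsRefl.nondegenerate_iff_separatingLeft (sympForm_isRefl n)).2 fun x hx => ?_
  by_contra hne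
  obtain ⟨y, hy⟩ := exists_sympForm_ne_zero hne
  exact hy (hx y)

theorem pauliXZ_apply {n : ℕ} (a b f g : QIdx n) :
    pauliXZ a b f g = if f = g + a then (-1 : ℂ) ^ (∑ i, b i * g i).val else 0 := by
  rw [pauliXZ, neg_one_pow_sum_val]

/-- The Pauli operator with a given label. -/
noncomputable def pauli {n : ℕ} (x : QIdx n × QIdx n) : Matrix (QIdx n) (QIdx n) ℂ :=
  pauliXZ x.1 x.2

theorem pauli_zero {n : ℕ} : pauli (0 : QIdx n × QIdx n) = 1 := by
  ext f g
  simp [pauli, pauliXZ_apply, Matrix.one_apply]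

theorem pauli_mul {n : ℕ} (x y : QIdx n × QIdx n) :
    pauli x * pauli y = (-1 : ℂ) ^ (∑ i, x.2 i * y.1 i).val • pauli (x + y) := by
  ext f g
  simp only [pauli, Matrix.mul_apply, pauliXZ_apply, Matrix.smul_apply, Prod.fst_add,
    Prod.snd_add, Pi.add_apply, smul_eq_mul, mul_ite, mul_zero, Finset.sum_ite_eq',
    Finset.mem_univ, if_true, ite_mul, zero_mul]
  have h : f = g + y.1 + x.1 ↔ f = g + (x.1 + y.1) := by rw [add_assoc, add_comm y.1]
  rw [if_congr h rfl rfl]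
  split_ifs
  · rw [← neg_one_pow_val_add, ← neg_one_pow_val_add, ← Finset.sum_add_distrib,
      ← Finset.sum_add_distrib]
    congr 2
    exact Finset.sum_congr rfl fun k _ => by ring
  · rfl

theorem pauli_mul_comm {n : ℕ} (x y : QIdx n × QIdx n) :
    pauli x * pauli y = (-1 : ℂ) ^ (sympForm n x y).val • (pauli y * pauli x) := by
  rw [pauli_mul, pauli_mul, add_comm y x, smul_smul, ← neg_one_pow_val_add, sympForm_apply,
    ← Finset.sum_add_distrib]
  congr 3
  refine Finset.sum_congr rfl fun k _ => ?_
  have h : x.1 k * y.2 k + x.1 k * y.2 k = 0 := CharTwo.add_self_eq_zero _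
  linear_combination -h

theorem pauli_commute {n : ℕ} {x y : QIdx n × QIdx n} (h : sympForm n x y = 0) :
    Commute (pauli x) (pauli y) := by
  rw [Commute, SemiconjBy, pauli_mul_comm, h]
  simp

theorem pauli_anticommute {n : ℕ} {x y : QIdx n × QIdx n} (h : sympForm n x y ≠ 0) :
    pauli x * pauli y = -(pauli y * pauli x) := by
  rw [pauli_mul_comm, zmod_two_eq_one h]
  simp [ZMod.val_one]

theorem pauli_mul_self {n : ℕ} (x : QIdx n × QIdx n) :
    ∃ s : ℂ, s ≠ 0 ∧ pauli x * pauli x = s • 1 := by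
  have h : x + x = 0 := by
    ext i <;> exact CharTwo.add_self_eq_zero _
  refine ⟨_, ?_, by rw [pauli_mul, h, pauli_zero]⟩
  exact pow_ne_zero _ (by norm_num)

theorem eq_zero_of_pauli_mul_eq_zero {n : ℕ} {x : QIdx n × QIdx n}
    {M : Matrix (QIdx n) (QIdx n) ℂ} (h : pauli x * M = 0) : M = 0 := by
  obtain ⟨s, hs, hxx⟩ := pauli_mul_self x
  have h1 : pauli x * (pauli x * M) = 0 := by rw [h, mul_zero]
  rw [← mul_assoc, hxx, smul_mul_assoc, one_mul] at h1
  exact (smul_eq_zero.1 h1).resolve_left hs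

theorem trace_pauli_eq_zero {n : ℕ} {x : QIdx n × QIdx n} (hx : x ≠ 0) :
    (pauli x).trace = 0 := by
  obtain ⟨y, hy⟩ := exists_sympForm_ne_zero hx
  obtain ⟨s, hs, hyy⟩ := pauli_mul_self y
  have h1 : (pauli x * pauli y * pauli y).trace = s * (pauli x).trace := by
    rw [mul_assoc, hyy, mul_smul_comm, mul_one, Matrix.trace_smul, smul_eq_mul]
  have h2 : (pauli x * pauli y * pauli y).trace = -(s * (pauli x).trace) := by
    rw [← h1]
    nth_rw 1 [pauli_anticommute hy]
    rw [neg_mul, Matrix.trace_neg, mul_assoc, Matrix.trace_mul_comm]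
  have h3 : s * (pauli x).trace = 0 := by
    rw [h2] at h1
    linear_combination (-1 / 2 : ℂ) * h1
  exact (mul_eq_zero.1 h3).resolve_left hs

/-- The product of the operators `1 + s X^a Z^b` over a list of signs and labels. -/
noncomputable def pauliProd {n : ℕ} (l : List (ℂ × (QIdx n × QIdx n))) :
    Matrix (QIdx n) (QIdx n) ℂ :=
  (l.map fun p => 1 + p.1 • pauli p.2).prod

theorem trace_pauliProd_mul_pauli {n : ℕ} (l : List (ℂ × (QIdx n × QIdx n)))
    (hl : ∀ p ∈ l, ‖p.1‖ = 1) (x : QIdx n × QIdx n) :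
    (x ∉ Submodule.span (ZMod 2) {y | y ∈ l.map Prod.snd} →
      (pauliProd l * pauli x).trace = 0) ∧
    2 ^ Module.finrank (ZMod 2) (Submodule.span (ZMod 2) {y | y ∈ l.map Prod.snd})
      * ‖(pauliProd l * pauli x).trace‖ ≤ (2 : ℝ) ^ (n + l.length) := by
  induction l generalizing x with
  | nil =>
    have h0 : {y : QIdx n × QIdx n | y ∈ ([] : List (ℂ × (QIdx n × QIdx n))).map Prod.snd} = ∅ := by
      ext; simp
    rw [h0, Submodule.span_empty]
    simp only [pauliProd, List.map_nil, List.prod_nil, one_mul, Submodule.mem_bot, finrank_bot,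
      pow_zero, List.length_nil, add_zero]
    refine ⟨trace_pauli_eq_zero, ?_⟩
    by_cases hx : x = 0
    · rw [hx, pauli_zero, Matrix.trace_one]
      simp
    · rw [trace_pauli_eq_zero hx, norm_zero]
      positivity
  | cons p l ih =>
    obtain ⟨s, y⟩ := p
    have hs : ‖s‖ = 1 := hl (s, y) (by simp)
    have ih' := ih fun p hp => hl p (by simp [hp])
    set P := Submodule.span (ZMod 2) {y | y ∈ l.map Prod.snd} with hP
    have hset : {z | z ∈ ((s, y) :: l).map Prod.snd} = insert y {z | z ∈ l.map Prod.snd} := by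
      ext; simp
    rw [hset]
    set Q := Submodule.span (ZMod 2) (insert y {z | z ∈ l.map Prod.snd}) with hQ
    have hPQ : P ≤ Q := Submodule.span_mono (Set.subset_insert _ _)
    have hyQ : y ∈ Q := Submodule.subset_span (Set.mem_insert _ _)
    obtain ⟨e, he, htr⟩ : ∃ e : ℂ, ‖e‖ = 1 ∧ (pauliProd ((s, y) :: l) * pauli x).trace
        = (pauliProd l * pauli x).trace + e * (pauliProd l * pauli (x + y)).trace := by
      refine ⟨s * (-1) ^ (∑ i, x.2 i * y.1 i).val, by simp [hs], ?_⟩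
      have h1 : pauliProd ((s, y) :: l) = (1 + s • pauli y) * pauliProd l := by
        simp [pauliProd]
      have h2 : (pauli y * pauliProd l * pauli x).trace
          = (-1) ^ (∑ i, x.2 i * y.1 i).val * (pauliProd l * pauli (x + y)).trace := by
        rw [mul_assoc, Matrix.trace_mul_comm, mul_assoc, pauli_mul, mul_smul_comm,
          Matrix.trace_smul, smul_eq_mul]
      rw [h1, add_mul, one_mul, add_mul, Matrix.trace_add, smul_mul_assoc, smul_mul_assoc,
        Matrix.trace_smul, smul_eq_mul, h2, mul_assoc]
    have hnorm : ‖(pauliProd ((s, y) :: l) * pauli x).trace‖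
        ≤ ‖(pauliProd l * pauli x).trace‖ + ‖(pauliProd l * pauli (x + y)).trace‖ := by
      rw [htr]
      refine (norm_add_le _ _).trans ?_
      rw [norm_mul, he, one_mul]
    constructor
    · intro hx
      have h2 : x + y ∉ P := fun h => hx (by simpa using Q.sub_mem (hPQ h) hyQ)
      rw [htr, (ih' x).1 fun h => hx (hPQ h), (ih' (x + y)).1 h2]
      simp
    · rw [List.length_cons, ← add_assoc, pow_succ]
      obtain ⟨hx0, hx⟩ := ih' x
      obtain ⟨hxy0, hxy⟩ := ih' (x + y)
      by_cases hyP : y ∈ P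
      · have hQP : Q = P := by rw [hQ, Submodule.span_insert_eq_span hyP]
        rw [hQP]
        have h3 := mul_le_mul_of_nonneg_left hnorm
          (show (0 : ℝ) ≤ 2 ^ Module.finrank (ZMod 2) P by positivity)
        linarith
      · have hfin : Module.finrank (ZMod 2) Q ≤ Module.finrank (ZMod 2) P + 1 := by
          rw [hQ, Submodule.span_insert]
          refine (Submodule.finrank_add_le_finrank_add_finrank _ _).trans ?_
          have := finrank_span_le_card (R := ZMod 2) {y}
          simp only [Set.toFinset_singleton, Finset.card_singleton] at this
          change _ + Module.finrank (ZMod 2) P ≤ _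
          omega
        have hpow : (2 : ℝ) ^ Module.finrank (ZMod 2) Q ≤ 2 ^ Module.finrank (ZMod 2) P * 2 := by
          rw [← pow_succ]
          exact pow_le_pow_right₀ (by norm_num) hfin
        have h4 := mul_le_mul_of_nonneg_right hpow
          (norm_nonneg (pauliProd ((s, y) :: l) * pauli x).trace)
        have h3 := mul_le_mul_of_nonneg_left hnorm
          (show (0 : ℝ) ≤ 2 ^ Module.finrank (ZMod 2) P by positivity)
        by_cases hxP : x ∈ P
        · have h5 : x + y ∉ P := fun h => hyP (by simpa using P.sub_mem h hxP)
          rw [hxy0 h5, norm_zero, add_zero] at h3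
          linarith
        · rw [hx0 hxP, norm_zero, zero_add] at h3
          linarith

namespace StabCode

variable {n m : ℕ} (S : StabCode n m)

/-- The space of labels of stabilizers. -/
def stabSpace : Submodule (ZMod 2) (QIdx n × QIdx n) :=
  Submodule.span (ZMod 2) (Set.range S.gen)

/-- The space of labels of Pauli operators commuting with all stabilizers. -/
def logicalSpace : Submodule (ZMod 2) (QIdx n × QIdx n) :=
  (sympForm n).orthogonal S.stabSpace

theorem proj_eq : S.proj = ((2 : ℂ) ^ m)⁻¹ •
    pauliProd (List.ofFn fun i => (S.sign i, S.gen i)) := by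
  rw [proj, pauliProd, List.map_ofFn]
  rfl

theorem add_finrank_stabSpace_le {k : ℕ} (hk : HasDim S k) :
    k + Module.finrank (ZMod 2) S.stabSpace ≤ n := by
  have h := (trace_pauliProd_mul_pauli (List.ofFn fun i => (S.sign i, S.gen i)) (by
    intro p hp
    rw [List.mem_ofFn] at hp
    obtain ⟨i, rfl⟩ := hp
    rcases S.sign_pm i with h | h <;> simp [h]) 0).2
  have hset : {y | y ∈ (List.ofFn fun i => (S.sign i, S.gen i)).map Prod.snd}
      = Set.range S.gen := by
    ext y
    simp [List.mem_ofFn]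
  rw [hset, ← stabSpace, pauli_zero, mul_one, List.length_ofFn] at h
  have hn : ‖(pauliProd (List.ofFn fun i => (S.sign i, S.gen i))).trace‖
      = (2 : ℝ) ^ m * 2 ^ k := by
    have h1 : (pauliProd (List.ofFn fun i => (S.sign i, S.gen i))).trace = 2 ^ m * 2 ^ k := by
      rw [HasDim, proj_eq, Matrix.trace_smul, smul_eq_mul] at hk
      rw [← hk]
      field_simp
    rw [h1]
    simp
  rw [hn, ← pow_add, ← pow_add] at h
  have := (pow_le_pow_iff_right₀ (by norm_num : (1 : ℝ) < 2)).1 h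
  omega

theorem mem_logicalSpace_iff {v : QIdx n × QIdx n} :
    v ∈ S.logicalSpace ↔ ∀ i, sympForm n (S.gen i) v = 0 := by
  constructor
  · intro h i
    exact h _ (Submodule.subset_span ⟨i, rfl⟩)
  · intro h x hx
    change sympForm n x v = 0
    induction hx using Submodule.span_induction with
    | mem x hx => obtain ⟨i, rfl⟩ := hx; exact h i
    | zero => simp
    | add x y _ _ hx hy => rw [map_add, LinearMap.add_apply, hx, hy, add_zero]
    | smul a x _ hx => rw [map_smul, LinearMap.smul_apply, hx, smul_zero]

theorem pauli_commute_proj {v : QIdx n × QIdx n} (hv : v ∈ S.logicalSpace) :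
    Commute (pauli v) S.proj := by
  rw [proj_eq]
  refine Commute.smul_right (Commute.list_prod_right _ _ ?_) _
  simp only [List.map_ofFn, List.mem_ofFn]
  rintro _ ⟨i, rfl⟩
  refine (Commute.one_right _).add_right (Commute.smul_right (pauli_commute ?_) _)
  rw [sympForm_comm]
  exact S.mem_logicalSpace_iff.1 hv i

theorem mem_stabSpace_of_card_lt {k d : ℕ} (hk : HasDim S k) (hd : HasDistanceGe S d)
    {v : QIdx n × QIdx n} (hv : v ∈ S.logicalSpace) (hvd : (pauliSupp v.1 v.2).card < d) :
    v ∈ S.stabSpace := by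
  by_contra hvS
  have htr : S.proj.trace ≠ 0 := by
    rw [HasDim] at hk
    rw [hk]
    exact pow_ne_zero _ two_ne_zero
  have hP : S.proj ≠ 0 := fun h => htr (by rw [h, Matrix.trace_zero])
  obtain ⟨w, hw, hvw⟩ : ∃ w ∈ S.logicalSpace, sympForm n w v ≠ 0 := by
    by_contra! h
    apply hvS
    rw [← LinearMap.BilinForm.orthogonal_orthogonal (sympForm_nondegenerate n)
      (sympForm_isRefl n) S.stabSpace]
    exact fun w hw => h w hw
  obtain ⟨z₀, hz₀⟩ := hd 0 0 (by simpa [pauliSupp] using (Nat.zero_le _).trans_lt hvd)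
  have h00 : pauliXZ (0 : QIdx n) 0 = 1 := pauli_zero
  rw [h00, mul_one] at hz₀
  have hz₀' : z₀ ≠ 0 := by
    rintro rfl
    rw [zero_smul] at hz₀
    have hnil : IsNilpotent S.proj := ⟨2, by rw [pow_two, hz₀]⟩
    exact htr (Matrix.isNilpotent_trace_of_isNilpotent hnil).eq_zero
  obtain ⟨z, hz⟩ := hd v.1 v.2 hvd
  change S.proj * pauli v * S.proj = _ at hz
  rw [← (S.pauli_commute_proj hv).eq, mul_assoc, hz₀, mul_smul_comm] at hz
  obtain ⟨μ, hμ⟩ : ∃ μ : ℂ, pauli v * S.proj = μ • S.proj := by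
    refine ⟨z₀⁻¹ * z, ?_⟩
    rw [mul_smul, ← hz, smul_smul, inv_mul_cancel₀ hz₀', one_smul]
  have h1 : pauli w * (pauli v * S.proj) = μ • (pauli w * S.proj) := by
    rw [hμ, mul_smul_comm]
  have h2 : pauli w * (pauli v * S.proj) = -(μ • (pauli w * S.proj)) := by
    rw [← mul_assoc, pauli_anticommute hvw, neg_mul, mul_assoc, (S.pauli_commute_proj hw).eq,
      ← mul_assoc, hμ, smul_mul_assoc]
  have h3 : μ • (pauli w * S.proj) = 0 := by
    have h4 : (2 : ℂ) • (μ • (pauli w * S.proj)) = 0 := by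
      rw [two_smul]
      nth_rewrite 1 [← h1]
      rw [h2, neg_add_cancel]
    exact (smul_eq_zero.1 h4).resolve_left two_ne_zero
  rcases smul_eq_zero.1 h3 with rfl | h
  · rw [zero_smul] at hμ
    exact hP (eq_zero_of_pauli_mul_eq_zero hμ)
  · exact hP (eq_zero_of_pauli_mul_eq_zero h)

end StabCode

/-- A Pauli label supported on `U`. -/
def SupportedOn {n : ℕ} (U : Finset (Fin n)) (x : QIdx n × QIdx n) : Prop :=
  ∀ i ∉ U, x.1 i = 0 ∧ x.2 i = 0

/-- Restriction of a Pauli label to `U`, extended by zero. -/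
def restrictLabel {n : ℕ} (U : Finset (Fin n)) :
    (QIdx n × QIdx n) →ₗ[ZMod 2] (QIdx n × QIdx n) where
  toFun x := (fun i => if i ∈ U then x.1 i else 0, fun i => if i ∈ U then x.2 i else 0)
  map_add' x y := by
    ext i <;> simp only [Prod.fst_add, Prod.snd_add, Pi.add_apply] <;> split_ifs <;> simp
  map_smul' a x := by
    ext i <;> simp

theorem restrictLabel_fst {n : ℕ} (U : Finset (Fin n)) (x : QIdx n × QIdx n) (i : Fin n) :
    (restrictLabel U x).1 i = if i ∈ U then x.1 i else 0 := rfl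

theorem restrictLabel_snd {n : ℕ} (U : Finset (Fin n)) (x : QIdx n × QIdx n) (i : Fin n) :
    (restrictLabel U x).2 i = if i ∈ U then x.2 i else 0 := rfl

theorem supportedOn_restrictLabel {n : ℕ} (U : Finset (Fin n)) (x : QIdx n × QIdx n) :
    SupportedOn U (restrictLabel U x) := fun i hi => by
  simp [restrictLabel_fst, restrictLabel_snd, hi]

theorem sympForm_restrictLabel {n : ℕ} (U : Finset (Fin n)) (x y : QIdx n × QIdx n) :
    sympForm n (restrictLabel U x) y = sympForm n x (restrictLabel U y) := by
  simp only [sympForm_apply, restrictLabel_fst, restrictLabel_snd]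
  exact Finset.sum_congr rfl fun k _ => by split_ifs <;> simp

theorem SupportedOn.mono {n : ℕ} {U W : Finset (Fin n)} {x : QIdx n × QIdx n}
    (hx : SupportedOn U x) (h : U ⊆ W) : SupportedOn W x := fun i hi => hx i fun hU => hi (h hU)

theorem SupportedOn.add {n : ℕ} {U : Finset (Fin n)} {x y : QIdx n × QIdx n}
    (hx : SupportedOn U x) (hy : SupportedOn U y) : SupportedOn U (x + y) := fun i hi => by
  simp [hx i hi, hy i hi]

theorem SupportedOn.smul {n : ℕ} {U : Finset (Fin n)} {x : QIdx n × QIdx n} (a : ZMod 2)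
    (hx : SupportedOn U x) : SupportedOn U (a • x) := fun i hi => by
  simp [hx i hi]

namespace StabCode

variable {n m : ℕ} (S : StabCode n m)

/-- The sets supporting no nontrivial logical operator. -/
def cleanable : Set (Finset (Fin n)) :=
  {U | ∀ v ∈ S.logicalSpace, SupportedOn U v → v ∈ S.stabSpace}

theorem stabSpace_le_logicalSpace : S.stabSpace ≤ S.logicalSpace :=
  Submodule.span_le.2 <| by
    rintro _ ⟨j, rfl⟩
    exact S.mem_logicalSpace_iff.2 fun i => S.commute i j

/-- The stabilizers generated by the generators meeting `U`. -/
def localStabSpace (U : Finset (Fin n)) : Submodule (ZMod 2) (QIdx n × QIdx n) :=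
  Submodule.span (ZMod 2)
    {x | ∃ i, x = S.gen i ∧ ∃ u ∈ U, u ∈ pauliSupp (S.gen i).1 (S.gen i).2}

theorem localStabSpace_le (U : Finset (Fin n)) : S.localStabSpace U ≤ S.stabSpace :=
  Submodule.span_mono fun _ ⟨i, hi, _⟩ => ⟨i, hi.symm⟩

theorem supportedOn_of_mem_localStabSpace {U : Finset (Fin n)} {x : QIdx n × QIdx n}
    (hx : x ∈ S.localStabSpace U) : SupportedOn (U ∪ outerBoundary (connGraph S) U) x := by
  induction hx using Submodule.span_induction with
  | mem x hx =>
    obtain ⟨i, rfl, u, hu, hui⟩ := hx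
    intro j hj
    by_contra h
    have hji : j ∈ pauliSupp (S.gen i).1 (S.gen i).2 := by
      simp only [pauliSupp, Finset.mem_filter, Finset.mem_univ, true_and]
      tauto
    apply hj
    by_cases hjU : j ∈ U
    · simp [hjU]
    · simp only [Finset.mem_union, outerBoundary, Finset.mem_filter, Finset.mem_univ, true_and]
      refine .inr ⟨hjU, u, hu, ?_⟩
      rw [connGraph, SimpleGraph.fromRel_adj]
      exact ⟨fun h => hjU (h ▸ hu), .inl ⟨i, hui, hji⟩⟩
  | zero => intro i _; simp
  | add x y _ _ hx hy => exact hx.add hy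
  | smul a x _ hx => exact hx.smul a

theorem exists_restrictLabel_eq_of_mem_stabSpace (U : Finset (Fin n)) {x : QIdx n × QIdx n}
    (hx : x ∈ S.stabSpace) :
    ∃ y ∈ S.localStabSpace U, restrictLabel U y = restrictLabel U x := by
  suffices h : S.stabSpace.map (restrictLabel U) ≤ (S.localStabSpace U).map (restrictLabel U) from
    h ⟨x, hx, rfl⟩
  rw [stabSpace, Submodule.map_span, Submodule.span_le]
  rintro _ ⟨_, ⟨i, rfl⟩, rfl⟩
  by_cases h : ∃ u ∈ U, u ∈ pauliSupp (S.gen i).1 (S.gen i).2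
  · exact ⟨S.gen i, Submodule.subset_span ⟨i, rfl, h⟩, rfl⟩
  · push Not at h
    have h0 : restrictLabel U (S.gen i) = 0 := by
      have h' : ∀ u ∈ U, (S.gen i).1 u = 0 ∧ (S.gen i).2 u = 0 := by
        intro u hu
        have := h u hu
        simp only [pauliSupp, Finset.mem_filter, Finset.mem_univ, true_and] at this
        tauto
      ext u
      · simpa [restrictLabel_fst] using fun hu => (h' u hu).1
      · simpa [restrictLabel_snd] using fun hu => (h' u hu).2
    rw [h0]
    exact Submodule.zero_mem _

/-- Cleaning lemma: a logical operator agrees on a cleanable set with a stabilizer generated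
near that set. -/
theorem exists_localStabSpace_of_mem_cleanable {U : Finset (Fin n)} (hU : U ∈ S.cleanable)
    {v : QIdx n × QIdx n} (hv : v ∈ S.logicalSpace) :
    ∃ s ∈ S.localStabSpace U, restrictLabel U s = restrictLabel U v := by
  have h : restrictLabel U v ∈ S.stabSpace.map (restrictLabel U) := by
    rw [← LinearMap.BilinForm.orthogonal_orthogonal (sympForm_nondegenerate n)
      (sympForm_isRefl n) (S.stabSpace.map (restrictLabel U))]
    intro y hy
    change sympForm n y (restrictLabel U v) = 0
    rw [← sympForm_restrictLabel]
    refine hv _ (hU _ ?_ (supportedOn_restrictLabel U y))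
    refine fun s hs => ?_
    change sympForm n s (restrictLabel U y) = 0
    rw [← sympForm_restrictLabel]
    exact hy _ ⟨s, hs, rfl⟩
  obtain ⟨s, hs, hsv⟩ := h
  obtain ⟨t, ht, hts⟩ := S.exists_restrictLabel_eq_of_mem_stabSpace U hs
  exact ⟨t, ht, hts.trans hsv⟩

/-- Subtracting a label which agrees with `v` on `U` removes `U` from the support. -/
theorem _root_.SupportedOn.sub_of_restrictLabel_eq {U T : Finset (Fin n)}
    {v s : QIdx n × QIdx n} (hv : SupportedOn (U ∪ T) v) (hs : SupportedOn (U ∪ T) s)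
    (h : restrictLabel U s = restrictLabel U v) : SupportedOn T (v - s) := by
  intro i hi
  by_cases hiU : i ∈ U
  · have h1 := congrFun (congrArg Prod.fst h) i
    have h2 := congrFun (congrArg Prod.snd h) i
    simp only [restrictLabel_fst, restrictLabel_snd, hiU, if_true] at h1 h2
    simp [h1, h2]
  · have hi' : i ∉ U ∪ T := by simp [hi, hiU]
    simp [hv i hi', hs i hi']

theorem isCorrectableFamily_cleanable {k d : ℕ} (hk : HasDim S k) (hd : HasDistanceGe S d) :
    IsCorrectableFamily (connGraph S) d S.cleanable := by
  refine ⟨fun U hU W hWU v hv hvW => hU v hv (hvW.mono hWU), ?_, ?_, ?_⟩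
  · intro U hUd v hv hvU
    refine S.mem_stabSpace_of_card_lt hk hd hv ((Finset.card_le_card ?_).trans_lt hUd)
    intro i hi
    by_contra hiU
    simp [pauliSupp, hvU i hiU] at hi
  · intro ℓ U hU hdis v hv hvU
    have hsum : ∑ j, restrictLabel (U j) v = v := by
      have hi : ∀ (f : QIdx n), (∀ i ∉ Finset.univ.biUnion U, f i = 0) → ∀ i,
          ∑ j, (if i ∈ U j then f i else 0) = f i := by
        intro f hf i
        by_cases h : i ∈ Finset.univ.biUnion U
        · obtain ⟨j, -, hj⟩ := Finset.mem_biUnion.1 h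
          rw [Finset.sum_eq_single j, if_pos hj]
          · intro j' _ hjj
            exact if_neg fun hj' => Finset.disjoint_left.1 (hdis j' j hjj).1 hj' hj
          · simp
        · simp [hf i h]
      ext i
      · simpa [Prod.fst_sum, restrictLabel_fst] using hi v.1 (fun i hi => (hvU i hi).1) i
      · simpa [Prod.snd_sum, restrictLabel_snd] using hi v.2 (fun i hi => (hvU i hi).2) i
    rw [← hsum]
    refine Submodule.sum_mem _ fun j _ => hU j _ ?_ (supportedOn_restrictLabel _ _)
    rw [mem_logicalSpace_iff]
    intro i
    have hv' := S.mem_logicalSpace_iff.1 hv i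
    have hzero : ∀ W : Finset (Fin n), (∀ u ∈ W, u ∉ pauliSupp (S.gen i).1 (S.gen i).2) →
        sympForm n (S.gen i) (restrictLabel W v) = 0 := by
      intro W hW
      rw [sympForm_apply]
      refine Finset.sum_eq_zero fun u _ => ?_
      by_cases hu : u ∈ W
      · have := hW u hu
        simp only [pauliSupp, Finset.mem_filter, Finset.mem_univ, true_and, not_or,
          not_not] at this
        simp [this.1, this.2]
      · simp [restrictLabel_fst, restrictLabel_snd, hu]
    by_cases hj : ∃ u ∈ U j, u ∈ pauliSupp (S.gen i).1 (S.gen i).2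
    · obtain ⟨u, hu, hui⟩ := hj
      rw [← hsum, map_sum, Finset.sum_eq_single j] at hv'
      · exact hv'
      · intro j' _ hjj
        refine hzero _ fun w hw hwi => (hdis j j' hjj.symm).2 u hu w hw ?_
        rw [connGraph, SimpleGraph.fromRel_adj]
        refine ⟨?_, .inl ⟨i, hui, hwi⟩⟩
        rintro rfl
        exact Finset.disjoint_left.1 (hdis j j' hjj.symm).1 hu hw
      · simp
    · push Not at hj
      exact hzero _ hj
  · intro U hU T hT hUT v hv hvUT
    obtain ⟨s, hs, hsv⟩ := S.exists_localStabSpace_of_mem_cleanable hU hv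
    have hsS := S.localStabSpace_le U hs
    have hsU := (S.supportedOn_of_mem_localStabSpace hs).mono
      (Finset.union_subset_union_right hUT)
    have h := hT (v - s) (Submodule.sub_mem _ hv (S.stabSpace_le_logicalSpace hsS))
      (hvUT.sub_of_restrictLabel_eq hsU hsv)
    simpa using Submodule.add_mem _ h hsS

/-- The number of logical qubits is at most the number of qubits outside two cleanable sets. -/
theorem le_card_of_cleanable {k : ℕ} (hk : HasDim S k) {A B : Finset (Fin n)}
    (hA : A ∈ S.cleanable) (hB : B ∈ S.cleanable) :
    k ≤ ((Finset.univ \ A) \ B).card := by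
  set C := (Finset.univ \ A) \ B with hC
  let Z : Submodule (ZMod 2) (QIdx n × QIdx n) :=
    { carrier := {v | v ∈ S.logicalSpace ∧ SupportedOn (Finset.univ \ A) v}
      add_mem' := fun hx hy => ⟨Submodule.add_mem _ hx.1 hy.1, hx.2.add hy.2⟩
      zero_mem' := ⟨Submodule.zero_mem _, fun i _ => by simp⟩
      smul_mem' := fun a x hx => ⟨Submodule.smul_mem _ a hx.1, hx.2.smul a⟩ }
  have hle : S.logicalSpace ≤ S.stabSpace ⊔ Z := by
    intro v hv
    obtain ⟨s, hs, hsv⟩ := S.exists_localStabSpace_of_mem_cleanable hA hv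
    have hsS := S.localStabSpace_le A hs
    refine Submodule.mem_sup.2 ⟨s, hsS, v - s,
      ⟨Submodule.sub_mem _ hv (S.stabSpace_le_logicalSpace hsS), ?_⟩, by abel⟩
    have huniv : ∀ x : QIdx n × QIdx n, SupportedOn (A ∪ Finset.univ \ A) x := fun x i hi => by
      simp at hi
    exact (huniv v).sub_of_restrictLabel_eq (huniv s) hsv
  let ρ : (QIdx n × QIdx n) →ₗ[ZMod 2] ((C → ZMod 2) × (C → ZMod 2)) :=
    (LinearMap.funLeft (ZMod 2) (ZMod 2) Subtype.val).prodMap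
      (LinearMap.funLeft (ZMod 2) (ZMod 2) Subtype.val)
  have hker : (LinearMap.ker (ρ.domRestrict Z)).map Z.subtype ≤ S.stabSpace ⊓ Z := by
    rintro _ ⟨⟨v, hvZ⟩, hv, rfl⟩
    refine ⟨hB v hvZ.1 fun i hiB => ?_, hvZ⟩
    by_cases hiA : i ∈ A
    · exact hvZ.2 i (by simp [hiA])
    · have hiC : i ∈ C := by simp [hC, hiA, hiB]
      have hv' : ρ v = 0 := hv
      exact ⟨congrFun (congrArg Prod.fst hv') ⟨i, hiC⟩,
        congrFun (congrArg Prod.snd hv') ⟨i, hiC⟩⟩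
  have h1 := (ρ.domRestrict Z).finrank_range_add_finrank_ker
  have h2 := Submodule.finrank_mono hker
  rw [Submodule.finrank_map_subtype_eq] at h2
  have h3 := Submodule.finrank_le (LinearMap.range (ρ.domRestrict Z))
  have h4 := Submodule.finrank_sup_add_finrank_inf_eq S.stabSpace Z
  have h5 := Submodule.finrank_mono hle
  have h6 : Module.finrank (ZMod 2) S.logicalSpace =
      Module.finrank (ZMod 2) (QIdx n × QIdx n) - Module.finrank (ZMod 2) S.stabSpace :=
    LinearMap.BilinForm.finrank_orthogonal (sympForm_nondegenerate n) S.stabSpace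
  have h7 := S.add_finrank_stabSpace_le hk
  simp only [Module.finrank_prod, Module.finrank_fintype_fun_eq_card, Fintype.card_fin,
    Fintype.card_coe] at h3 h6
  omega

end StabCode

/-- main theorem: for `β ≥ 1`, `c ∈ (0,1)` there is `α = α(β,c) > 0` such
that any `⟦n,k,d⟧` stabilizer code whose connectivity graph `G` satisfies
`s_G(r) ≤ β r^c` for all `r` obeys `k·d^{(1−c²)/c} ≤ α·n`. -/
theorem kd_tradeoff_main (β c : ℝ) (hβ : 1 ≤ β) (hc0 : 0 < c) (hc1 : c < 1) :
    ∃ α : ℝ, 0 < α ∧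
      ∀ (n m k d : ℕ) (S : StabCode n m),
        HasDim S k → HasDistanceGe S d → HasSepProfile (connGraph S) β c →
        (k : ℝ) * (d : ℝ) ^ ((1 - c ^ 2) / c) ≤ α * n := by
  obtain ⟨α, hα, h⟩ := exists_correctable_partition β c hβ hc0 hc1
  refine ⟨α, hα, fun n m k d S hk hd hsep => ?_⟩
  obtain ⟨A, hA, B, hB, hAB⟩ := h n d _ _ (S.isCorrectableFamily_cleanable hk hd) hsep
  have hkC : (k : ℝ) ≤ ((Finset.univ \ A) \ B).card := by
    exact_mod_cast S.le_card_of_cleanable hk hA hB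
  exact (mul_le_mul_of_nonneg_right hkC (by positivity)).trans hAB
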